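/- arXiv:2203.05533 — 5 statements merged into one kernel-verified Lean document; each statement's English description precedes it below -/
import Mathlib

section
/- Fix t > 0. For every θ in the upper half-plane ℍ = {θ ∈ ℂ : Im θ > 0}, the equation ζ - t·tan ζ = θ has exactly one solution ζ with Im ζ > 0. Moreover, the map θ ↦ ζ_t(θ) assigning to each θ ∈ ℍ this unique solution is holomorphic on ℍ. -/
open Complex

lemma aux_sinh_mono {q p : ℝ} (hq : 0 ≤ q) (hqp : q ≤ p) :
    p * Real.sinh q ≤ q * Real.sinh p := by
  rcases eq_or_lt_of_le (hq.trans hqp) with hp | hp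
  · have : q = 0 := by linarith
    subst this; subst hp; simp
  have hc : ConvexOn ℝ (Set.Ici (0:ℝ)) Real.sinh := by
    apply convexOn_of_deriv2_nonneg' (convex_Ici 0)
    · exact Real.differentiable_sinh.differentiableOn
    · rw [Real.deriv_sinh]; exact Real.differentiable_cosh.differentiableOn
    · intro x hx
      simpa [Real.deriv_sinh, Real.deriv_cosh, Real.sinh_nonneg_iff] using hx
  have h := hc.2 (Set.mem_Ici.2 (le_refl (0:ℝ))) (Set.mem_Ici.2 hp.le)
    (show (0:ℝ) ≤ 1 - q / p by rw [sub_nonneg, div_le_one hp]; exact hqp)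
    (show (0:ℝ) ≤ q / p by positivity) (by ring)
  simp only [smul_eq_mul, mul_zero, zero_add, Real.sinh_zero, div_mul_cancel₀ _ hp.ne'] at h
  calc p * Real.sinh q ≤ p * (q / p * Real.sinh p) := by gcongr
    _ = q * Real.sinh p := by field_simp

lemma aux_self_le {y : ℝ} (hy : 0 ≤ y) : y ≤ Real.sinh y * Real.cosh y := by
  have h1 := Real.self_le_sinh_iff.2 hy
  have h2 := Real.one_le_cosh y
  nlinarith

lemma aux_sinh_ineq {y v : ℝ} (hy : 0 < y) (hv : 0 < v) :
    Real.sinh (y - v) ^ 2 * (y * v) ≤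
      (y - v) ^ 2 * ((Real.sinh y * Real.cosh y) * (Real.sinh v * Real.cosh v)) := by
  have h0 : (y + v) * Real.sinh |y - v| ≤ |y - v| * Real.sinh (y + v) :=
    aux_sinh_mono (abs_nonneg _) (by rw [abs_le]; constructor <;> linarith)
  have hs : Real.sinh |y - v| ^ 2 = Real.sinh (y - v) ^ 2 := by
    rcases abs_choice (y - v) with h | h <;> rw [h]
    rw [Real.sinh_neg]; ring
  have h1 : (y + v) ^ 2 * Real.sinh (y - v) ^ 2 ≤ (y - v) ^ 2 * Real.sinh (y + v) ^ 2 := by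
    have := pow_le_pow_left₀ (mul_nonneg (by linarith) (Real.sinh_nonneg_iff.2 (abs_nonneg _))) h0 2
    rwa [mul_pow, mul_pow, hs, sq_abs] at this
  have h2 : Real.sinh (y + v) ^ 2 - Real.sinh (y - v) ^ 2 =
      4 * ((Real.sinh y * Real.cosh y) * (Real.sinh v * Real.cosh v)) := by
    rw [Real.sinh_add, Real.sinh_sub]; ring
  have h3 : (Real.sinh y * Real.cosh y) * (Real.sinh v * Real.cosh v) =
    (Real.sinh (y + v) ^ 2 - Real.sinh (y - v) ^ 2) / 4 := by linarith
  rw [h3]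
  nlinarith

lemma aux_sin_re (z : ℂ) : (Complex.sin z).re = Real.sin z.re * Real.cosh z.im := by
  rw [Complex.sin_eq, ← Complex.ofReal_sin, ← Complex.ofReal_cos, ← Complex.ofReal_sinh,
    ← Complex.ofReal_cosh]
  simp only [add_re, sub_re, mul_re, add_im, sub_im, mul_im, ofReal_re, ofReal_im, I_re, I_im]
  ring
lemma aux_sin_im (z : ℂ) : (Complex.sin z).im = Real.cos z.re * Real.sinh z.im := by
  rw [Complex.sin_eq, ← Complex.ofReal_sin, ← Complex.ofReal_cos, ← Complex.ofReal_sinh,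
    ← Complex.ofReal_cosh]
  simp only [add_re, sub_re, mul_re, add_im, sub_im, mul_im, ofReal_re, ofReal_im, I_re, I_im]
  ring
lemma aux_cos_re (z : ℂ) : (Complex.cos z).re = Real.cos z.re * Real.cosh z.im := by
  rw [Complex.cos_eq, ← Complex.ofReal_sin, ← Complex.ofReal_cos, ← Complex.ofReal_sinh,
    ← Complex.ofReal_cosh]
  simp only [add_re, sub_re, mul_re, add_im, sub_im, mul_im, ofReal_re, ofReal_im, I_re, I_im]
  ring
lemma aux_cos_im (z : ℂ) : (Complex.cos z).im = - (Real.sin z.re * Real.sinh z.im) := by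
  rw [Complex.cos_eq, ← Complex.ofReal_sin, ← Complex.ofReal_cos, ← Complex.ofReal_sinh,
    ← Complex.ofReal_cosh]
  simp only [add_re, sub_re, mul_re, add_im, sub_im, mul_im, ofReal_re, ofReal_im, I_re, I_im]
  ring

lemma aux_normSq_sin (z : ℂ) :
    normSq (Complex.sin z) = Real.sin z.re ^ 2 + Real.sinh z.im ^ 2 := by
  rw [normSq_apply, aux_sin_re, aux_sin_im]
  have h1 := Real.sin_sq_add_cos_sq z.re
  have h2 := Real.cosh_sq z.im
  linear_combination Real.sin z.re ^ 2 * h2 + Real.sinh z.im ^ 2 * h1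

lemma aux_normSq_cos (z : ℂ) :
    normSq (Complex.cos z) = Real.cos z.re ^ 2 + Real.sinh z.im ^ 2 := by
  rw [normSq_apply, aux_cos_re, aux_cos_im]
  have h1 := Real.sin_sq_add_cos_sq z.re
  have h2 := Real.cosh_sq z.im
  linear_combination Real.cos z.re ^ 2 * h2 + Real.sinh z.im ^ 2 * h1

lemma aux_cos_pos {z : ℂ} (hz : 0 < z.im) : 0 < normSq (Complex.cos z) := by
  rw [aux_normSq_cos]
  have := Real.sinh_pos_iff.2 hz
  positivity

lemma aux_cos_ne {z : ℂ} (hz : 0 < z.im) : Complex.cos z ≠ 0 :=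
  normSq_pos.1 (aux_cos_pos hz)

lemma aux_tan_im (z : ℂ) :
    (Complex.tan z).im = Real.sinh z.im * Real.cosh z.im / normSq (Complex.cos z) := by
  rw [Complex.tan_eq_sin_div_cos, Complex.div_im, ← sub_div, aux_sin_re, aux_sin_im, aux_cos_re, aux_cos_im]
  congr 1
  have h1 := Real.sin_sq_add_cos_sq z.re
  linear_combination Real.sinh z.im * Real.cosh z.im * h1

lemma aux_tan_im_pos {z : ℂ} (hz : 0 < z.im) : 0 < (Complex.tan z).im := by
  rw [aux_tan_im]
  exact div_pos (mul_pos (Real.sinh_pos_iff.2 hz) (Real.cosh_pos _)) (aux_cos_pos hz)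

lemma aux_pick {z w : ℂ} (hz : 0 < z.im) (hw : 0 < w.im) :
    normSq (Complex.tan z - Complex.tan w) * (z.im * w.im) ≤
      normSq (z - w) * ((Complex.tan z).im * (Complex.tan w).im) := by
  have e : Complex.tan z - Complex.tan w = Complex.sin (z - w) / (Complex.cos z * Complex.cos w) := by
    rw [Complex.tan_eq_sin_div_cos, Complex.tan_eq_sin_div_cos,
      div_sub_div _ _ (aux_cos_ne hz) (aux_cos_ne hw), Complex.sin_sub]
  rw [e, normSq_div, normSq_mul, aux_tan_im, aux_tan_im, div_mul_div_comm, div_mul_eq_mul_div,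
    ← mul_div_assoc]
  have := aux_cos_pos hz
  have := aux_cos_pos hw
  apply div_le_div_of_nonneg_right _ (by positivity)
  rw [aux_normSq_sin, normSq_apply, sub_re, sub_im]
  have h1 := aux_sinh_ineq hz hw
  have h2 := Real.sin_sq_le_sq (x := z.re - w.re)
  have h3 : z.im * w.im ≤ (Real.sinh z.im * Real.cosh z.im) * (Real.sinh w.im * Real.cosh w.im) :=
    mul_le_mul (aux_self_le hz.le) (aux_self_le hw.le) hw.le (hz.le.trans (aux_self_le hz.le))
  have h4 := mul_le_mul h2 h3 (by positivity) (sq_nonneg _)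
  linarith

lemma aux_tan_bound {b : ℝ} (hb : 0 < b) {z : ℂ} (hz : b ≤ z.im) :
    ‖Complex.tan z‖ ≤ 1 + 1 / Real.sinh b := by
  have hs := Real.sinh_pos_iff.2 hb
  have hsz : Real.sinh b ≤ Real.sinh z.im := Real.sinh_le_sinh.2 hz
  have hc := aux_cos_pos (hb.trans_le hz)
  apply (sq_le_sq₀ (norm_nonneg _) (by positivity)).1
  rw [← normSq_eq_norm_sq, Complex.tan_eq_sin_div_cos, normSq_div, div_le_iff₀ hc,
    aux_normSq_sin, aux_normSq_cos]
  have h1 := Real.sin_sq_le_one z.re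
  have h2 : 1 ≤ (1 / Real.sinh b) ^ 2 * Real.sinh z.im ^ 2 := by
    rw [← mul_pow]
    apply one_le_pow₀
    rw [one_div_mul_eq_div, one_le_div hs]; exact hsz
  have h3 : 0 < 1 / Real.sinh b := by positivity
  nlinarith [sq_nonneg (Real.cos z.re), sq_nonneg (Real.sinh z.im), mul_nonneg (sq_nonneg (1 + 1 / Real.sinh b)) (sq_nonneg (Real.cos z.re)), mul_nonneg h3.le (sq_nonneg (Real.sinh z.im))]

lemma aux_contract {t : ℝ} (ht : 0 < t) {θ z w : ℂ} (hθ : 0 < θ.im) (hz : 0 < z.im) (hw : 0 < w.im)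
    (hne : z ≠ w) :
    normSq ((θ + t * Complex.tan z) - (θ + t * Complex.tan w)) * (z.im * w.im) <
      normSq (z - w) * ((θ + t * Complex.tan z).im * (θ + t * Complex.tan w).im) := by
  have e : (θ + t * Complex.tan z) - (θ + t * Complex.tan w) =
    t * (Complex.tan z - Complex.tan w) := by ring
  have hp : 0 < normSq (z - w) := normSq_pos.2 (sub_ne_zero.2 hne)
  rw [e, normSq_mul, normSq_ofReal]
  simp only [add_im, im_ofReal_mul]
  have h := mul_le_mul_of_nonneg_left (aux_pick hz hw) (mul_pos ht ht).le
  have hz' := mul_pos ht (aux_tan_im_pos hz)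
  have hw' := mul_pos ht (aux_tan_im_pos hw)
  have h5 : (t * (Complex.tan z).im) * (t * (Complex.tan w).im) <
     (θ.im + t * (Complex.tan z).im) * (θ.im + t * (Complex.tan w).im) := by nlinarith [mul_pos hθ hz', mul_pos hθ hw']
  have h6 := mul_lt_mul_of_pos_left h5 hp
  linarith

lemma aux_unique {t : ℝ} (ht : 0 < t) {θ z w : ℂ} (hθ : 0 < θ.im) (hz : 0 < z.im) (hw : 0 < w.im)
    (hz2 : z - t * Complex.tan z = θ) (hw2 : w - t * Complex.tan w = θ) : z = w := by
  by_contra hne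
  have h := aux_contract ht hθ hz hw hne
  rw [← sub_eq_iff_eq_add.1 hz2, ← sub_eq_iff_eq_add.1 hw2] at h
  exact lt_irrefl _ h

lemma aux_exists {t : ℝ} (ht : 0 < t) {θ : ℂ} (hθ : 0 < θ.im) :
    ∃ z : ℂ, 0 < z.im ∧ z - t * Complex.tan z = θ := by
  set g : ℂ → ℂ := fun z => θ + t * Complex.tan z with hg
  set R := t * (1 + 1 / Real.sinh θ.im) with hR
  have hRpos : 0 < R := by
    have := Real.sinh_pos_iff.2 hθ
    positivity
  set K : Set ℂ := Metric.closedBall θ R ∩ {z | θ.im ≤ z.im} with hK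
  have hKc : IsCompact K :=
    (isCompact_closedBall θ R).inter_right (isClosed_le continuous_const continuous_im)
  have hpos : ∀ z ∈ K, 0 < z.im := fun z hz => hθ.trans_le hz.2
  have hmap : ∀ z ∈ K, g z ∈ K := by
    intro z hz
    refine ⟨?_, ?_⟩
    · simp only [hg, Metric.mem_closedBall, dist_eq_norm, add_sub_cancel_left, norm_mul,
        norm_real, Real.norm_eq_abs, abs_of_pos ht]
      exact mul_le_mul_of_nonneg_left (aux_tan_bound hθ hz.2) ht.le
    · have := mul_pos ht (aux_tan_im_pos (hpos z hz))
      simp only [hg, Set.mem_ofPred_eq, add_im, im_ofReal_mul]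
      linarith
  have hgc : ContinuousOn g K := by
    intro z hz
    have := (Complex.hasDerivAt_tan (aux_cos_ne (hpos z hz))).continuousAt
    exact (continuousAt_const.add (continuousAt_const.mul this)).continuousWithinAt
  obtain ⟨z, hz, hmin⟩ := hKc.exists_isMinOn (f := fun z => normSq (z - g z) / (z.im * (g z).im))
    ⟨θ, by simp [hK, hRpos.le]⟩ (by
      apply ContinuousOn.div
      · exact continuous_normSq.comp_continuousOn (continuousOn_id.sub hgc)
      · exact continuous_im.continuousOn.mul (continuous_im.comp_continuousOn hgc)
      · intro x hx
        exact (mul_pos (hpos x hx) (hpos _ (hmap x hx))).ne')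
  refine ⟨z, hpos z hz, ?_⟩
  by_contra hne
  have hne' : z ≠ g z := fun h => hne (by rw [sub_eq_iff_eq_add]; exact h)
  have h1 := hpos z hz
  have h2 := hpos _ (hmap z hz)
  have h3 := hpos _ (hmap _ (hmap z hz))
  have hc := aux_contract ht hθ h1 h2 hne'
  have hm := hmin (hmap z hz)
  simp only [Set.mem_ofPred_eq] at hm
  rw [div_le_div_iff₀ (by positivity) (by positivity)] at hm
  exact absurd hc (not_lt.2 hm)

lemma aux_deriv_ne {t : ℝ} (ht : 0 < t) {z : ℂ} (hz : 0 < z.im)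
    (h : 0 < (z - t * Complex.tan z).im) : (1 - t * (1 / Complex.cos z ^ 2) : ℂ) ≠ 0 := by
  intro h0
  have hc := aux_cos_ne hz
  have h1 : (t : ℂ) = Complex.cos z ^ 2 := by
    field_simp at h0
    linear_combination -h0
  have h2 : t = normSq (Complex.cos z) := by
    rw [normSq_eq_norm_sq, ← norm_pow, ← h1, norm_real, Real.norm_eq_abs, abs_of_pos ht]
  rw [sub_im, im_ofReal_mul, aux_tan_im, ← h2, mul_div_cancel₀ _ ht.ne'] at h
  linarith [aux_self_le hz.le]

theorem exists_unique_solution_and_holomorphic (t : ℝ) (ht : 0 < t) :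
    (∀ θ : ℂ, 0 < θ.im →
      ∃! ζ : ℂ, 0 < ζ.im ∧ ζ - (t : ℂ) * Complex.tan ζ = θ) ∧
    ∃ f : ℂ → ℂ, DifferentiableOn ℂ f {θ : ℂ | 0 < θ.im} ∧
      ∀ θ : ℂ, 0 < θ.im → 0 < (f θ).im ∧ f θ - (t : ℂ) * Complex.tan (f θ) = θ := by
  refine ⟨fun θ hθ => ?_, ?_⟩
  · obtain ⟨z, hz, hz2⟩ := aux_exists ht hθ
    exact ⟨z, ⟨hz, hz2⟩, fun w hw => aux_unique ht hθ hw.1 hz hw.2 hz2⟩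
  have hex : ∀ θ : ℂ, ∃ z : ℂ, 0 < θ.im → 0 < z.im ∧ z - (t : ℂ) * Complex.tan z = θ := by
    intro θ
    by_cases hθ : 0 < θ.im
    · obtain ⟨z, hz⟩ := aux_exists ht hθ
      exact ⟨z, fun _ => hz⟩
    · exact ⟨0, fun h => absurd h hθ⟩
  choose f hf using hex
  refine ⟨f, ?_, hf⟩
  intro θ hθ
  replace hθ : 0 < θ.im := hθ
  obtain ⟨hz, hz2⟩ := hf θ hθ
  have hd : HasStrictDerivAt (fun z : ℂ => z - t * Complex.tan z)
      (1 - t * (1 / Complex.cos (f θ) ^ 2)) (f θ) :=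
    (hasStrictDerivAt_id _).sub ((Complex.hasStrictDerivAt_tan (aux_cos_ne hz)).const_mul _)
  have hne := aux_deriv_ne ht hz (by rw [hz2]; exact hθ)
  have hleft : ∀ᶠ x in nhds (f θ), f (x - t * Complex.tan x) = x := by
    have e1 : ∀ᶠ x in nhds (f θ), 0 < x.im :=
      continuous_im.continuousAt.eventually (lt_mem_nhds hz)
    have e2 : ∀ᶠ x in nhds (f θ), 0 < (x - t * Complex.tan x).im :=
      (continuous_im.continuousAt.comp hd.hasDerivAt.continuousAt).eventually
        (lt_mem_nhds (by simpa only [Function.comp, hz2] using hθ))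
    filter_upwards [e1, e2] with x h1 h2
    obtain ⟨h3, h4⟩ := hf _ h2
    exact aux_unique ht h2 h3 h1 h4 rfl
  have := hd.to_local_left_inverse hne hleft
  simp only [hz2] at this
  exact this.hasDerivAt.differentiableAt.differentiableWithinAt
end

section
/- Let D ⊆ ℂ be a nonempty open connected set and let h_1, h_2, … : D → ℂ be holomorphic functions. Suppose that Re h_n(z) → 0 as n → ∞ for every z ∈ D, and that for every compact set K ⊆ D there is a constant C with Re h_n(z) ≤ C for all n ∈ ℕ and z ∈ K. Then the derivatives h_n' converge to 0 uniformly on every compact subset of D. -/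
open Filter

theorem aux_bc (f : ℂ → ℂ) (a : ℂ) (R M : ℝ) (hM : 0 < M) (hR : 0 < R)
    (hf : DifferentiableOn ℂ f (Metric.ball a R))
    (hb : ∀ z ∈ Metric.ball a R, (f z).re - (f a).re ≤ M) (z : ℂ) (hz : dist z a < R) :
    ‖f z - f a‖ ≤ 2 * M * dist z a / (R - dist z a) := by
  have hmaps : Set.MapsTo (fun w : ℂ => a + w) (Metric.ball 0 R) (Metric.ball a R) := by
    intro w hw
    simpa [dist_eq_norm] using hw
  have h1 : DifferentiableOn ℂ (fun w => f (a + w) - f a) (Metric.ball 0 R) := by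
    refine DifferentiableOn.sub_const ?_ _
    exact hf.comp (by fun_prop) hmaps
  have h2 := Complex.borelCaratheodory_zero (f := fun w => f (a + w) - f a) (z := z - a) hM h1
    (by
      intro w hw
      have := hb _ (hmaps hw)
      simpa using this) hR (by simpa [dist_eq_norm] using hz) (by simp)
  simpa [dist_eq_norm] using h2

theorem aux_deriv (f : ℂ → ℂ) (a : ℂ) (R M : ℝ) (hM : 0 < M) (hR : 0 < R)
    (hf : DifferentiableOn ℂ f (Metric.ball a R))
    (hb : ∀ z ∈ Metric.ball a R, (f z).re - (f a).re ≤ M) :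
    ‖deriv f a‖ ≤ 4 * M / R := by
  have hc : Metric.closedBall a (R / 2) ⊆ Metric.ball a R :=
    Metric.closedBall_subset_ball (by linarith)
  have h1 : DiffContOnCl ℂ (fun z => f z - f a) (Metric.ball a (R / 2)) := by
    refine DifferentiableOn.diffContOnCl ?_
    refine DifferentiableOn.sub_const (hf.mono ?_) _
    rw [closure_ball _ (by positivity)]
    exact hc
  have h2 := Complex.norm_deriv_le_of_forall_mem_sphere_norm_le (C := 2 * M)
    (by positivity : 0 < R / 2) h1 (by
      intro z hz
      rw [Metric.mem_sphere] at hz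
      have := aux_bc f a R M hM hR hf hb z (by rw [hz]; linarith)
      refine this.trans (le_of_eq ?_)
      rw [hz]
      field_simp
      ring)
  rw [deriv_sub_const] at h2
  refine h2.trans (le_of_eq ?_)
  field_simp
  ring

/-- If holomorphic functions `h_n` on a domain `D` have real parts tending to `0`
pointwise and locally uniformly bounded from above, then `h_n' → 0` locally uniformly. -/
theorem deriv_tendsto_of_re_tendsto (D : Set ℂ) (hD : IsOpen D) (hne : D.Nonempty)
    (hconn : IsConnected D) (h : ℕ → ℂ → ℂ)
    (hol : ∀ n : ℕ, DifferentiableOn ℂ (h n) D)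
    (hre : ∀ z ∈ D, Tendsto (fun n : ℕ => (h n z).re) atTop (nhds 0))
    (hbd : ∀ K : Set ℂ, K ⊆ D → IsCompact K → ∃ C : ℝ, ∀ n : ℕ, ∀ z ∈ K, (h n z).re ≤ C) :
    ∀ K : Set ℂ, K ⊆ D → IsCompact K →
      TendstoUniformlyOn (fun (n : ℕ) (z : ℂ) => deriv (h n) z) 0 atTop K := by
  have hloc : TendstoLocallyUniformlyOn (fun n z => (h n z).re) (fun _ => (0 : ℝ)) atTop D := by
    rw [Metric.tendstoLocallyUniformlyOn_iff]
    intro ε hε a ha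
    obtain ⟨R, hR, hRD⟩ := Metric.nhds_basis_closedBall.mem_iff.1 (hD.mem_nhds ha)
    obtain ⟨C, hC⟩ := hbd _ hRD (isCompact_closedBall a R)
    set M : ℝ := |C| + 1 with hMdef
    have hM : 0 < M := by positivity
    have hlim : Tendsto (fun t : ℝ => 2 * M * t / (R - t)) (nhds 0) (nhds 0) := by
      have : ContinuousAt (fun t : ℝ => 2 * M * t / (R - t)) 0 := by
        refine ContinuousAt.div (by fun_prop) (by fun_prop) (by simpa using hR.ne')
      simpa [ContinuousAt] using this
    have hdist : Tendsto (fun z : ℂ => dist z a) (nhds a) (nhds 0) := by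
      have : ContinuousAt (fun z : ℂ => dist z a) a := by fun_prop
      simpa [ContinuousAt] using this
    have hsmall := (hlim.comp hdist).eventually (gt_mem_nhds (half_pos hε))
    refine ⟨_, mem_nhdsWithin_of_mem_nhds (inter_mem hsmall (Metric.ball_mem_nhds a hR)), ?_⟩
    have hm : 0 < min (ε / 2) 1 := by positivity
    filter_upwards [(Metric.tendsto_nhds.1 (hre a ha)) _ hm] with n hn z hz
    rw [Real.dist_eq, sub_zero, lt_min_iff] at hn
    obtain ⟨hz1, hz2⟩ := hz
    have hz1' : 2 * M * dist z a / (R - dist z a) < ε / 2 := hz1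
    have hb := aux_bc (h n) a R M hM hR
      ((hol n).mono (Metric.ball_subset_closedBall.trans hRD)) (by
        intro w hw
        have h1 := hC n w (Metric.ball_subset_closedBall hw)
        have h2 := le_abs_self C
        have h3 := neg_abs_le (h n a).re
        linarith [hn.2]) z hz2
    have h4 := Complex.abs_re_le_norm (h n z - h n a)
    rw [Complex.sub_re] at h4
    have h5 : |(h n z).re| ≤ |(h n z).re - (h n a).re| + |(h n a).re| := by
      have := abs_add_le ((h n z).re - (h n a).re) (h n a).re
      simpa using this
    rw [dist_comm, Real.dist_eq, sub_zero]
    linarith [hn.1]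
  intro K hKD hK
  obtain ⟨δ, hδ, hδD⟩ := hK.exists_cthickening_subset_open hD hKD
  have hu := (tendstoLocallyUniformlyOn_iff_forall_isCompact hD).1 hloc _ hδD hK.cthickening
  rw [Metric.tendstoUniformlyOn_iff] at hu ⊢
  intro ε hε
  filter_upwards [hu (ε * δ / 16) (by positivity)] with n hn z hz
  have hsub : Metric.ball z δ ⊆ Metric.cthickening δ K :=
    (Metric.ball_subset_thickening hz δ).trans (Metric.thickening_subset_cthickening δ K)
  have h1 := aux_deriv (h n) z δ (ε * δ / 8) (by positivity) hδ
    ((hol n).mono (hsub.trans hδD)) (by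
      intro w hw
      have a1 := hn w (hsub hw)
      have a2 := hn z (hsub (Metric.mem_ball_self hδ))
      rw [dist_comm, Real.dist_eq, sub_zero] at a1 a2
      linarith [le_abs_self (h n w).re, neg_abs_le (h n z).re])
  have h2 : 4 * (ε * δ / 8) / δ = ε / 2 := by
    field_simp
    ring
  simp only [Pi.zero_apply, dist_zero_left]
  linarith
end

section
/- Let D ⊆ ℂ be a nonempty open connected set and let h_1, h_2, … : D → ℂ be holomorphic functions. Suppose that Re h_n(z) → 0 for every z ∈ D, that for every compact set K ⊆ D there is a constant C with Re h_n(z) ≤ C for all n ∈ ℕ and z ∈ K, and that h_n(y₀) → 0 for some point y₀ ∈ D. Then h_n → 0 uniformly on every compact subset of D. -/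
open Filter

lemma bc_aux {f : ℂ → ℂ} {c z : ℂ} {R M : ℝ} (hR : 0 < R) (hM : 0 < M)
    (hf : DifferentiableOn ℂ f (Metric.ball c R))
    (hb : ∀ w ∈ Metric.ball c R, (f w - f c).re ≤ M) (hz : dist z c ≤ R / 2) :
    ‖f z - f c‖ ≤ 4 * M * dist z c / R := by
  have hmaps : Set.MapsTo (fun u : ℂ => c + u) (Metric.ball 0 R) (Metric.ball c R) := by
    intro u hu
    simpa [Metric.mem_ball, dist_eq_norm] using hu
  have hzn : ‖z - c‖ ≤ R / 2 := by rwa [← dist_eq_norm]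
  have key := Complex.borelCaratheodory_zero (f := fun u => f (c + u) - f c) (z := z - c)
    (R := R) hM
    ((hf.comp (by fun_prop) hmaps).sub_const _)
    (fun u hu => hb _ (hmaps hu)) hR (by rw [mem_ball_zero_iff]; linarith) (by simp)
  simp only [add_sub_cancel] at key
  rw [dist_eq_norm]
  refine key.trans ?_
  rw [div_le_div_iff₀ (by linarith) hR]
  have : 0 ≤ M * ‖z - c‖ := by positivity
  nlinarith

lemma unif_aux {E : Type*} [NormedAddCommGroup E] {D : Set ℂ} {f : ℕ → ℂ → E}
    (heq : ∀ z ∈ D, ∀ ε > 0, ∃ δ > 0, ∀ n, ∀ w, dist w z < δ → ‖f n w - f n z‖ < ε)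
    (hp : ∀ z ∈ D, Tendsto (fun n => f n z) atTop (nhds 0))
    {K : Set ℂ} (hKD : K ⊆ D) (hK : IsCompact K) :
    TendstoUniformlyOn f 0 atTop K := by
  rw [← tendstoLocallyUniformlyOn_iff_tendstoUniformlyOn_of_compact hK,
    Metric.tendstoLocallyUniformlyOn_iff]
  intro ε hε z hz
  obtain ⟨δ, hδ, H⟩ := heq z (hKD hz) (ε / 2) (by linarith)
  refine ⟨Metric.ball z δ, mem_nhdsWithin_of_mem_nhds (Metric.ball_mem_nhds z hδ), ?_⟩
  filter_upwards [Metric.tendsto_nhds.1 (hp z (hKD hz)) (ε / 2) (by linarith)] with n hn w hw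
  have h1 := H n w hw
  rw [dist_zero_right] at hn
  simp only [Pi.zero_apply, dist_zero_left]
  have := norm_le_norm_sub_add (f n w) (f n z)
  linarith

/-- If holomorphic functions `h_n` on a domain `D` have real parts tending to `0`
pointwise and locally uniformly bounded from above, and `h_n(y₀) → 0` at some point
`y₀ ∈ D`, then `h_n → 0` locally uniformly on `D`. -/
theorem tendsto_of_re_tendsto (D : Set ℂ) (hD : IsOpen D) (hne : D.Nonempty)
    (hconn : IsConnected D) (h : ℕ → ℂ → ℂ)
    (hol : ∀ n : ℕ, DifferentiableOn ℂ (h n) D)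
    (hre : ∀ z ∈ D, Tendsto (fun n : ℕ => (h n z).re) atTop (nhds 0))
    (hbd : ∀ K : Set ℂ, K ⊆ D → IsCompact K → ∃ C : ℝ, ∀ n : ℕ, ∀ z ∈ K, (h n z).re ≤ C)
    (y₀ : ℂ) (hy₀ : y₀ ∈ D) (hpt : Tendsto (fun n : ℕ => h n y₀) atTop (nhds 0)) :
    ∀ K : Set ℂ, K ⊆ D → IsCompact K →
      TendstoUniformlyOn (fun (n : ℕ) (z : ℂ) => h n z) 0 atTop K := by
  have hequi : ∀ z ∈ D, ∀ ε > 0, ∃ δ > 0, ∀ n, ∀ w, dist w z < δ →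
      ‖h n w - h n z‖ < ε := by
    intro z hz ε hε
    obtain ⟨R, hR, hRD⟩ := Metric.nhds_basis_closedBall.mem_iff.1 (hD.mem_nhds hz)
    obtain ⟨C, hC⟩ := hbd _ hRD (isCompact_closedBall z R)
    obtain ⟨B, hB⟩ := (hre z hz).bddBelow_range
    have hM : 0 < |C - B| + 1 := by positivity
    set M := |C - B| + 1 with hMdef
    refine ⟨min (R / 2) (ε * R / (4 * M)), by positivity, fun n w hw => ?_⟩
    have h1 := bc_aux (f := h n) (z := w) hR hM
      ((hol n).mono (Metric.ball_subset_closedBall.trans hRD)) (fun u hu => by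
        have h2 := hC n u (Metric.ball_subset_closedBall hu)
        have h3 : B ≤ (h n z).re := hB ⟨n, rfl⟩
        have h4 := le_abs_self (C - B)
        rw [Complex.sub_re]
        linarith) (hw.le.trans (min_le_left _ _))
    refine h1.trans_lt ?_
    have h5 := hw.trans_le (min_le_right _ _)
    rw [lt_div_iff₀ (by positivity)] at h5
    rw [div_lt_iff₀ hR]
    linarith
  have hequire : ∀ z ∈ D, ∀ ε > 0, ∃ δ > 0, ∀ n, ∀ w, dist w z < δ →
      ‖(h n w).re - (h n z).re‖ < ε := by
    intro z hz ε hε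
    obtain ⟨δ, hδ, H⟩ := hequi z hz ε hε
    refine ⟨δ, hδ, fun n w hw => lt_of_le_of_lt ?_ (H n w hw)⟩
    rw [← Complex.sub_re]
    exact Complex.abs_re_le_norm _
  have hloc : ∀ z ∈ D, ∃ δ > 0, ∀ w, dist w z < δ →
      Tendsto (fun n => h n w - h n z) atTop (nhds 0) := by
    intro z hz
    obtain ⟨R, hR, hRD⟩ := Metric.nhds_basis_closedBall.mem_iff.1 (hD.mem_nhds hz)
    have hu := unif_aux (f := fun n w => (h n w).re) hequire hre hRD (isCompact_closedBall z R)
    rw [Metric.tendstoUniformlyOn_iff] at hu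
    refine ⟨R / 2, by linarith, fun w hw => ?_⟩
    rw [Metric.tendsto_nhds]
    intro ε hε
    filter_upwards [hu (ε / 8) (by linarith)] with n hn
    simp only [Pi.zero_apply, dist_zero_left, Real.norm_eq_abs] at hn
    rw [dist_zero_right]
    have h1 := bc_aux (f := h n) (z := w) (M := ε / 4) hR (by linarith)
      ((hol n).mono (Metric.ball_subset_closedBall.trans hRD)) (fun u hu => by
        have h2 := abs_lt.1 (hn u (Metric.ball_subset_closedBall hu))
        have h3 := abs_lt.1 (hn z (Metric.mem_closedBall_self hR.le))
        rw [Complex.sub_re]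
        linarith [h2.2, h3.1]) hw.le
    refine h1.trans_lt ?_
    rw [div_lt_iff₀ hR]
    nlinarith
  have hall : ∀ z ∈ D, Tendsto (fun n => h n z) atTop (nhds 0) := by
    intro z hz
    have := hconn.isPreconnected.induction₂
      (fun x y => Tendsto (fun n => h n y - h n x) atTop (nhds 0))
      (fun x hx => by
        obtain ⟨δ, hδ, H⟩ := hloc x hx
        exact mem_nhdsWithin_of_mem_nhds
          (mem_of_superset (Metric.ball_mem_nhds x hδ) (fun w hw => H w hw)))
      (fun x y w _ _ _ h1 h2 => by simpa using h2.add h1)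
      (fun x y _ _ h1 => by simpa using h1.neg) hy₀ hz
    simpa using this.add hpt
  intro K hKD hK
  exact unif_aux hequi hall hKD hK
end

section
/- Fix σ > 0 and θ ∈ ℍ, and let ζ ∈ ℍ satisfy ζ - (σ²/4)·tan ζ = θ/2. Set w := -(i/2)·tan ζ - 1/2 (equivalently, w = i(θ - 2ζ)/σ² - 1/2). Then 1 + w ≠ 0 and (w/(1+w))·exp( σ²·(w + 1/2) ) = -e^{iθ}. -/
open Complex

/-- For `θ ∈ ℍ` and `ζ ∈ ℍ` with `ζ - (σ²/4)tan ζ = θ/2`, setting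
`w = -(i/2)tan ζ - 1/2`, one has `w = i(θ - 2ζ)/σ² - 1/2`, `1 + w ≠ 0` and
`(w/(1+w))·e^{σ²(w + 1/2)} = -e^{iθ}`. -/
theorem psi_transform_identity (σ : ℝ) (hσ : 0 < σ) (θ ζ : ℂ)
    (hθ : 0 < θ.im) (hζ : 0 < ζ.im)
    (heq : ζ - ((σ ^ 2 : ℂ) / 4) * Complex.tan ζ = θ / 2) :
    (-(Complex.I / 2) * Complex.tan ζ - 1 / 2 =
      Complex.I * (θ - 2 * ζ) / (σ ^ 2 : ℂ) - 1 / 2) ∧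
    (1 + (-(Complex.I / 2) * Complex.tan ζ - 1 / 2) ≠ 0) ∧
    ((-(Complex.I / 2) * Complex.tan ζ - 1 / 2) /
        (1 + (-(Complex.I / 2) * Complex.tan ζ - 1 / 2)) *
      Complex.exp ((σ ^ 2 : ℂ) * ((-(Complex.I / 2) * Complex.tan ζ - 1 / 2) + 1 / 2)) =
      -Complex.exp (Complex.I * θ)) := by
  have hs : (σ ^ 2 : ℂ) ≠ 0 := by
    have : (σ : ℂ) ≠ 0 := by exact_mod_cast hσ.ne'
    exact pow_ne_zero 2 this
  have hq : Complex.exp (2 * (Complex.I * ζ)) + 1 ≠ 0 := by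
    intro h
    have h1 : Complex.exp (2 * (Complex.I * ζ)) = -1 := eq_neg_of_add_eq_zero_left h
    have h2 := congrArg norm h1
    rw [Complex.norm_exp] at h2
    simp at h2
    linarith
  have ht : Complex.I * Complex.tan ζ =
      (Complex.exp (2 * (Complex.I * ζ)) - 1) / (Complex.exp (2 * (Complex.I * ζ)) + 1) := by
    have he : Complex.exp (Complex.I * ζ) ≠ 0 := Complex.exp_ne_zero _
    have hd : Complex.exp (2 * (Complex.I * ζ)) = Complex.exp (Complex.I * ζ) ^ 2 := by
      rw [← Complex.exp_nat_mul]; norm_num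
    have hn : Complex.exp (-ζ * Complex.I) = (Complex.exp (Complex.I * ζ))⁻¹ := by
      rw [← Complex.exp_neg]; congr 1; ring
    rw [hd] at hq ⊢
    rw [Complex.tan_eq_sin_div_cos, Complex.sin, Complex.cos, hn, mul_comm ζ Complex.I]
    generalize Complex.exp (Complex.I * ζ) = e at *
    have h3 : (e + e⁻¹) = (e ^ 2 + 1) / e := by field_simp
    have h4 : (e⁻¹ - e) = (1 - e ^ 2) / e := by field_simp
    rw [h3, h4]
    field_simp
    rw [Complex.I_sq]
    ring
  have hw : -(Complex.I / 2) * Complex.tan ζ - 1 / 2 =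
      -Complex.exp (2 * (Complex.I * ζ)) / (Complex.exp (2 * (Complex.I * ζ)) + 1) := by
    have : -(Complex.I / 2) * Complex.tan ζ - 1 / 2 =
      -(Complex.I * Complex.tan ζ) / 2 - 1 / 2 := by ring
    rw [this, ht]
    clear ht
    generalize Complex.exp (2 * (Complex.I * ζ)) = q at *
    field_simp
    ring
  have hw1 : 1 + (-(Complex.I / 2) * Complex.tan ζ - 1 / 2) =
      1 / (Complex.exp (2 * (Complex.I * ζ)) + 1) := by
    rw [hw]
    clear hw ht
    generalize Complex.exp (2 * (Complex.I * ζ)) = q at *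
    field_simp
    ring
  refine ⟨?_, ?_, ?_⟩
  · have : Complex.I * (θ - 2 * ζ) = (-(Complex.I / 2) * Complex.tan ζ) * (σ ^ 2 : ℂ) := by
      linear_combination (-2 * Complex.I) * heq
    rw [this, mul_div_cancel_right₀ _ hs]
  · rw [hw1]; exact one_div_ne_zero hq
  · have hx : (σ ^ 2 : ℂ) * ((-(Complex.I / 2) * Complex.tan ζ - 1 / 2) + 1 / 2) =
        Complex.I * θ - 2 * (Complex.I * ζ) := by
      linear_combination (2 * Complex.I) * heq
    rw [hx, hw1, hw, Complex.exp_sub]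
    have he := Complex.exp_ne_zero (2 * (Complex.I * ζ))
    clear hw1 hw ht
    generalize Complex.exp (2 * (Complex.I * ζ)) = q at *
    field_simp
end

section
/- Fix x ∈ (-2, 2). Suppose that for each sufficiently small σ > 0 we are given ζ_σ ∈ ℍ satisfying ζ_σ - (σ²/4)·tan ζ_σ = (σx - π)/2, and suppose ζ_σ → -π/2 as σ → 0+. Then lim_{σ → 0+} (Im ζ_σ)/σ = (1/4)·√(4 - x²); equivalently, σ·f_{σ²}(e^{iσx}) → (1/(2π))·√(4 - x²), where f_{σ²}(e^{iθ}) = (2/(πσ²))·Im ζ with ζ the corresponding solution at argument (θ - π)/2. -/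
open Complex Filter

/-- Semicircle approximation of the free unitary normal density as `σ → 0+`: if
`ζ_σ ∈ ℍ` solves `ζ_σ - (σ²/4)tan ζ_σ = (σx - π)/2` and `ζ_σ → -π/2`, then
`Im ζ_σ/σ → (1/4)√(4-x²)`; equivalently `σ·f_{σ²}(e^{iσx}) → (1/(2π))√(4-x²)`
where `f_{σ²}(e^{iθ}) = (2/(πσ²))·Im ζ`. -/
theorem semicircle_limit_of_density (x : ℝ) (hx1 : -2 < x) (hx2 : x < 2)
    (ζ : ℝ → ℂ)
    (hζ : ∀ᶠ σ in nhdsWithin (0 : ℝ) (Set.Ioi 0),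
      0 < (ζ σ).im ∧
        ζ σ - ((σ ^ 2 / 4 : ℝ) : ℂ) * Complex.tan (ζ σ) = (((σ * x - Real.pi) / 2 : ℝ) : ℂ))
    (hlim : Tendsto ζ (nhdsWithin (0 : ℝ) (Set.Ioi 0))
      (nhds ((-(Real.pi / 2) : ℝ) : ℂ))) :
    Tendsto (fun σ : ℝ => (ζ σ).im / σ) (nhdsWithin (0 : ℝ) (Set.Ioi 0))
      (nhds ((1 / 4) * Real.sqrt (4 - x ^ 2))) ∧
    Tendsto (fun σ : ℝ => σ * (2 / (Real.pi * σ ^ 2)) * (ζ σ).im)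
      (nhdsWithin (0 : ℝ) (Set.Ioi 0))
      (nhds ((1 / (2 * Real.pi)) * Real.sqrt (4 - x ^ 2))) := by
  have hw : Tendsto (fun σ => ζ σ + ((Real.pi / 2 : ℝ) : ℂ)) (nhdsWithin (0 : ℝ) (Set.Ioi 0))
      (nhds 0) := by
    have := hlim.add_const (((Real.pi / 2 : ℝ) : ℂ))
    simpa using this
  set w : ℝ → ℂ := fun σ => ζ σ + ((Real.pi / 2 : ℝ) : ℂ) with hwdef
  have him : ∀ σ, (w σ).im = (ζ σ).im := fun σ => by
    simp only [hwdef, Complex.add_im, Complex.ofReal_im, add_zero]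
  have hw0 : ∀ᶠ σ in nhdsWithin (0 : ℝ) (Set.Ioi 0), w σ ≠ 0 := by
    filter_upwards [hζ] with σ h h0
    have := him σ
    rw [h0] at this
    simp at this
    linarith [h.1]
  have hs : Tendsto (fun z : ℂ => Complex.sin z / z) (nhdsWithin 0 {0}ᶜ) (nhds 1) := by
    have h := (Complex.hasDerivAt_sin 0)
    rw [hasDerivAt_iff_tendsto_slope] at h
    simp only [Complex.cos_zero] at h
    refine h.congr fun z => ?_
    simp [slope_def_field]
  have hsw : Tendsto (fun σ => Complex.sin (w σ) / w σ) (nhdsWithin (0 : ℝ) (Set.Ioi 0))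
      (nhds 1) :=
    hs.comp (tendsto_nhdsWithin_iff.2 ⟨hw, hw0⟩)
  have hcw : Tendsto (fun σ => Complex.cos (w σ)) (nhdsWithin (0 : ℝ) (Set.Ioi 0)) (nhds 1) := by
    have := (Complex.continuous_cos.tendsto 0).comp hw
    simpa [Function.comp_def] using this
  have hg : Tendsto (fun σ => (x : ℂ) ^ 2 / 16
      - Complex.cos (w σ) / (Complex.sin (w σ) / w σ) / 4)
      (nhdsWithin (0 : ℝ) (Set.Ioi 0)) (nhds ((-((4 - x ^ 2) / 16) : ℝ) : ℂ)) := by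
    have h := ((hcw.div hsw one_ne_zero).div_const 4).const_sub ((x : ℂ) ^ 2 / 16)
    convert h using 2
    · rfl
    push_cast
    ring
  have hv : ∀ᶠ σ in nhdsWithin (0 : ℝ) (Set.Ioi 0),
      (w σ / σ - x / 4) ^ 2 = (x : ℂ) ^ 2 / 16
      - Complex.cos (w σ) / (Complex.sin (w σ) / w σ) / 4 := by
    filter_upwards [hζ, hw0, hsw.eventually_ne one_ne_zero, self_mem_nhdsWithin]
      with σ h h0 h1 hσ
    have hσ' : (σ : ℂ) ≠ 0 := by
      exact_mod_cast (ne_of_gt hσ)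
    have hsin : Complex.sin (w σ) ≠ 0 := fun h => h1 (by simp [h])
    have hz : ζ σ = w σ - (Real.pi : ℂ) / 2 := by
      simp only [hwdef]; push_cast; ring
    have e := h.2
    rw [hz, Complex.tan, Complex.sin_sub_pi_div_two, Complex.cos_sub_pi_div_two] at e
    push_cast at e
    generalize w σ = W at *
    generalize Complex.sin W = S at *
    generalize Complex.cos W = C at *
    have e2 : W * S + σ ^ 2 / 4 * C = σ * x / 2 * S := by
      field_simp at e
      linear_combination e / 8
    field_simp
    linear_combination 256 * W * e2
  have himv : ∀ᶠ σ in nhdsWithin (0 : ℝ) (Set.Ioi 0),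
      Real.sqrt ((‖(x : ℂ) ^ 2 / 16 - Complex.cos (w σ) / (Complex.sin (w σ) / w σ) / 4‖
        - ((x : ℂ) ^ 2 / 16 - Complex.cos (w σ) / (Complex.sin (w σ) / w σ) / 4).re) / 2)
        = (ζ σ).im / σ := by
    filter_upwards [hζ, hv, self_mem_nhdsWithin] with σ h h1 hσ
    rw [← h1]
    have hi : (w σ / σ - x / 4).im = (ζ σ).im / σ := by
      rw [Complex.sub_im, Complex.div_ofReal_im, him]
      have : ((x : ℂ) / 4).im = 0 := by
        have : ((x : ℂ) / 4) = ((x / 4 : ℝ) : ℂ) := by push_cast; rfl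
        rw [this, Complex.ofReal_im]
      rw [this, sub_zero]
    rw [← hi]
    have hpos : 0 ≤ (w σ / σ - x / 4).im := by
      rw [hi]
      exact div_nonneg h.1.le (le_of_lt hσ)
    generalize (w σ / σ - x / 4 : ℂ) = v at *
    rw [norm_pow, Complex.sq_norm, Complex.normSq_apply, sq v, Complex.mul_re]
    rw [show (v.re * v.re + v.im * v.im - (v.re * v.re - v.im * v.im)) / 2 = v.im ^ 2 by ring]
    exact Real.sqrt_sq hpos
  have main : Tendsto (fun σ : ℝ => (ζ σ).im / σ) (nhdsWithin (0 : ℝ) (Set.Ioi 0))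
      (nhds ((1 / 4) * Real.sqrt (4 - x ^ 2))) := by
    refine Tendsto.congr' himv ?_
    have h := ((hg.norm.sub ((Complex.continuous_re.tendsto _).comp hg)).div_const 2).sqrt
    have hx : 0 ≤ 4 - x ^ 2 := by nlinarith
    convert h using 2
    · rfl
    rw [Complex.norm_real, Complex.ofReal_re, norm_neg, Real.norm_of_nonneg (by positivity)]
    rw [show ((4 - x ^ 2) / 16 - -((4 - x ^ 2) / 16)) / 2 = (1 / 4) ^ 2 * (4 - x ^ 2) by ring]
    rw [Real.sqrt_mul (by positivity), Real.sqrt_sq (by norm_num)]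
  refine ⟨main, ?_⟩
  have h := main.const_mul (2 / Real.pi)
  have hpi := Real.pi_ne_zero
  rw [show 1 / (2 * Real.pi) * Real.sqrt (4 - x ^ 2)
    = 2 / Real.pi * (1 / 4 * Real.sqrt (4 - x ^ 2)) by field_simp; norm_num]
  refine h.congr' ?_
  filter_upwards [self_mem_nhdsWithin] with σ hσ
  have : σ ≠ 0 := ne_of_gt hσ
  field_simp
end
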